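/- There exist constants c > 0 and C > 0 such that the following holds. Let G be a finite abelian group, ε > 0, d ≥ 0, R ⊆ G a regular Bohr set of rank r, σ ≤ cε/(r2^d) such that C' = R_σ is a regular Bohr set, and {A_g}_{g∈C'} a collection of subsets of R with Σ_{g∈C'} |A_g| ≥ 2^{−d}|R||C'|. Define α_g = |A_g|/|G|, α = Σ_{g∈C'} α_g², f = Σ_{g∈C'} 1_{A_g} ∘ 1_{A_g+g}, and D(x) = |A_x| for x ∈ C' and D(x) = 0 otherwise. Then either (1) |⟨μ_f, μ_D⟩ − μ(R)^{-1}| ≤ ε·μ(R)^{-1}, or (2) there exists an even integer p with 2 ≤ p ≤ C(d+1) such that ‖α^{-1} Σ_{g∈C'} (1_{A_g} − α_g μ_R) ∘ (1_{A_g+g} − α_g μ_{R+g})‖_{p(μ_{C'})} ≥ (ε/2)·μ(R)^{-1}. -/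

import Mathlib

open scoped BigOperators Classical

noncomputable section

namespace SkewPaper

variable {G : Type*}

/-- Expectation (average) of `f` over a finite type: `E[f] = (1/|G|) ∑ x, f x`. -/
def expect [Fintype G] (f : G → ℝ) : ℝ := (∑ x, f x) / (Fintype.card G)

/-- Normalized inner product `⟨f, g⟩ = E_{x∈G} f(x) g(x)`. -/
def inprod [Fintype G] (f g : G → ℝ) : ℝ := expect (fun x => f x * g x)

/-- Convolution `(f ∗ g)(x) = E_{y∈G} f(y) g(x − y)`. -/
def conv [Fintype G] [AddCommGroup G] (f g : G → ℝ) : G → ℝ :=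
  fun x => expect (fun y => f y * g (x - y))

/-- Difference convolution `(f ∘ g)(x) = E_{y∈G} f(y) g(x + y)`. -/
def dconv [Fintype G] [AddCommGroup G] (f g : G → ℝ) : G → ℝ :=
  fun x => expect (fun y => f y * g (x + y))

/-- Indicator function `1_A` of a set `A`. -/
def ind (A : Set G) : G → ℝ := Set.indicator A (fun _ => (1 : ℝ))

/-- Normalized indicator `μ_A = (|G|/|A|) · 1_A`. -/
def muSet [Fintype G] (A : Set G) : G → ℝ :=
  fun x => ((Fintype.card G : ℝ) / (Nat.card A : ℝ)) * ind A x

/-- `μ_f = f / E[f]`, the normalization of `f` to have mean 1. -/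
def muFun [Fintype G] (f : G → ℝ) : G → ℝ := fun x => f x / expect f

/-- Weighted `L^p` norm `‖f‖_{p(ν)} = (E_x ν(x) |f(x)|^p)^{1/p}`. -/
def wnorm [Fintype G] (p : ℕ) (ν f : G → ℝ) : ℝ :=
  (expect (fun x => ν x * |f x| ^ p)) ^ ((p : ℝ)⁻¹)

/-- `L^p` norm with respect to the uniform measure. -/
def pnorm [Fintype G] (p : ℕ) (f : G → ℝ) : ℝ := wnorm p (fun _ => 1) f

/-- Sup norm `‖f‖_∞`. -/
def supNorm (f : G → ℝ) : ℝ := ⨆ x, |f x|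

/-- `A` is skew-corner-free: it contains no nontrivial skew corner
`(x,y), (x,y+h), (x+h,y')` with `h ≠ 0`. -/
def IsSkewCornerFree [AddCommGroup G] (A : Set (G × G)) : Prop :=
  ∀ x y y' h : G, (x, y) ∈ A → (x, y + h) ∈ A → (x + h, y') ∈ A → h = 0

/-- The set of quadruples `(x, y, y', h)` forming a skew corner of `A`. -/
def skewCorners [AddCommGroup G] (A : Set (G × G)) : Set (G × G × G × G) :=
  {q | (q.1, q.2.1) ∈ A ∧ (q.1, q.2.1 + q.2.2.2) ∈ A ∧ (q.1 + q.2.2.2, q.2.2.1) ∈ A}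

/-- The column `A_x = {y : (x,y) ∈ A}`. -/
def col (A : Set (G × G)) (x : G) : Set G := {y | (x, y) ∈ A}

/-- A Bohr set datum: a finite frequency set of characters together with a width. -/
structure BohrSet (G : Type*) [AddCommGroup G] where
  freq : Finset (AddChar G ℂ)
  width : ℝ

namespace BohrSet

variable [AddCommGroup G]

/-- The underlying set `Bohr(Γ, φ) = {x : |1 − γ(x)| ≤ φ for all γ ∈ Γ}`. -/
def toSet (B : BohrSet G) : Set G :=
  {x | ∀ γ ∈ B.freq, ‖(1 : ℂ) - γ x‖ ≤ B.width}

/-- The rank `|Γ|` of a Bohr set. -/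
def rank (B : BohrSet G) : ℕ := B.freq.card

/-- The dilate `B_ρ = Bohr(Γ, ρφ)`. -/
def dilate (B : BohrSet G) (ρ : ℝ) : BohrSet G := ⟨B.freq, ρ * B.width⟩

/-- `B'` is a sub-Bohr set of `B` (written `B' ≤ B`): its frequency set contains
that of `B` and its width is at most that of `B`. -/
def Sub (B' B : BohrSet G) : Prop := B.freq ⊆ B'.freq ∧ B'.width ≤ B.width

/-- A Bohr set of rank `r` is regular if for all `0 ≤ κ ≤ 1/(100r)`,
`|B_{1+κ}| ≤ (1+100κr)|B|` and `|B_{1−κ}| ≥ (1−100κr)|B|`. -/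
def IsRegular (B : BohrSet G) : Prop :=
  ∀ κ : ℝ, 0 ≤ κ → κ ≤ 1 / (100 * B.rank) →
    ((Nat.card (B.dilate (1 + κ)).toSet : ℝ) ≤ (1 + 100 * κ * B.rank) * (Nat.card B.toSet : ℝ) ∧
     (Nat.card (B.dilate (1 - κ)).toSet : ℝ) ≥ (1 - 100 * κ * B.rank) * (Nat.card B.toSet : ℝ))

/-- The density `μ(B) = |B|/|G|`. -/
def measure [Fintype G] (B : BohrSet G) : ℝ := (Nat.card B.toSet : ℝ) / (Fintype.card G : ℝ)

/-- The normalized indicator measure `μ_B`. -/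
def mu [Fintype G] (B : BohrSet G) : G → ℝ := muSet B.toSet

end BohrSet


/-- (r, λ)-simultaneously spread collection of subsets of 𝔽_q^n. -/
def SimSpread {F : Type*} [Field F] [Fintype F] {n : ℕ} {ι : Type*} [Fintype ι]
    (A : ι → Set (Fin n → F)) (r : ℕ) (lam : ℝ) : Prop :=
  ∀ V : Submodule F (Fin n → F), n ≤ Module.finrank F V + r →
    ∀ x : ι → Fin n → F,
      ∑ i, ((Nat.card ↥(((fun a => a - x i) '' A i) ∩ (V : Set (Fin n → F))) : ℝ) /
            (Nat.card (V : Set (Fin n → F)) : ℝ)) ^ 2 ≤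
        lam * ∑ i, ((Nat.card (A i) : ℝ) / ((Fintype.card F : ℝ) ^ n)) ^ 2

/-- (r, λ)-simultaneously spread in an ambient subspace `W`. -/
def SimSpreadIn {F : Type*} [Field F] [Fintype F] {n : ℕ} {ι : Type*} [Fintype ι]
    (W : Submodule F (Fin n → F)) (A : ι → Set (Fin n → F)) (r : ℕ) (lam : ℝ) : Prop :=
  ∀ V : Submodule F (Fin n → F), V ≤ W → Module.finrank F W ≤ Module.finrank F V + r →
    ∀ x : ι → Fin n → F, (∀ i, x i ∈ W) →
      ∑ i, ((Nat.card ↥(((fun a => a - x i) '' A i) ∩ (V : Set (Fin n → F))) : ℝ) /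
            (Nat.card (V : Set (Fin n → F)) : ℝ)) ^ 2 ≤
        lam * ∑ i, ((Nat.card (A i) : ℝ) / (Nat.card (W : Set (Fin n → F)) : ℝ)) ^ 2

/-- (r, δ, λ)-simultaneously spread collection of subsets of a regular Bohr set `B`. -/
def SimSpreadBohr {G : Type*} [AddCommGroup G] [Fintype G] {ι : Type*} [Fintype ι]
    (B : BohrSet G) (A : ι → Set G) (r : ℕ) (δ lam : ℝ) : Prop :=
  ∀ B' : BohrSet G, B'.Sub B → B'.IsRegular → B'.rank ≤ B.rank + r →
    δ * B.measure ≤ B'.measure →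
    ∀ x : ι → G,
      ∑ i, ((Nat.card ↥(((fun a => a - x i) '' A i) ∩ B'.toSet) : ℝ) /
            (Nat.card B'.toSet : ℝ)) ^ 2 ≤
        lam * ∑ i, ((Nat.card (A i) : ℝ) / (Nat.card B.toSet : ℝ)) ^ 2

lemma expect_sub [Fintype G] (f g : G → ℝ) :
    expect (fun x => f x - g x) = expect f - expect g := by
  simp only [expect, Finset.sum_sub_distrib, sub_div]

lemma expect_mono [Fintype G] {f g : G → ℝ} (h : ∀ x, f x ≤ g x) : expect f ≤ expect g := by
  unfold expect
  gcongr with x _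
  exact h x

lemma abs_expect_le [Fintype G] (f : G → ℝ) : |expect f| ≤ expect (fun x => |f x|) := by
  unfold expect
  rw [abs_div, Nat.abs_cast]
  gcongr
  exact Finset.abs_sum_le_sum_abs _ _

lemma expect_mul_const [Fintype G] (f : G → ℝ) (c : ℝ) :
    expect (fun x => f x * c) = expect f * c := by
  simp only [expect, ← Finset.sum_mul]
  ring

lemma expect_muFun [Fintype G] {f : G → ℝ} (h : expect f ≠ 0) : expect (muFun f) = 1 := by
  have : expect (muFun f) = expect f * (expect f)⁻¹ := by
    rw [← expect_mul_const]
    rfl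
  rw [this, mul_inv_cancel₀ h]

lemma ind_nonneg (A : Set G) (x : G) : 0 ≤ ind A x :=
  Set.indicator_nonneg (fun _ _ => zero_le_one) x

lemma ind_le_one (A : Set G) (x : G) : ind A x ≤ 1 :=
  Set.indicator_le' (fun _ _ => le_rfl) (fun _ _ => zero_le_one) x

lemma ind_mono {A B : Set G} (h : A ⊆ B) (x : G) : ind A x ≤ ind B x :=
  Set.indicator_le_indicator_of_subset h (fun _ => zero_le_one) x

lemma sum_ind [Fintype G] (A : Set G) : ∑ x, ind A x = Nat.card A := by
  simp only [ind, Set.indicator_apply]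
  rw [Finset.sum_boole, Nat.card_eq_fintype_card, Fintype.card_subtype]

lemma expect_ind [Fintype G] (A : Set G) :
    expect (ind A) = (Nat.card A : ℝ) / Fintype.card G := by
  rw [expect, sum_ind]

lemma natCard_image_add_right [AddCommGroup G] (A : Set G) (g : G) :
    Nat.card ((fun a => a + g) '' A) = Nat.card A :=
  Nat.card_image_of_injective (add_left_injective g) A

lemma ind_image_add_right [AddCommGroup G] (A : Set G) (g z : G) :
    ind ((fun a => a + g) '' A) z = ind A (z - g) := by
  have : z ∈ (fun a => a + g) '' A ↔ z - g ∈ A := by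
    constructor
    · rintro ⟨a, ha, rfl⟩
      simpa using ha
    · intro h
      exact ⟨z - g, h, by simp⟩
  simp only [ind, Set.indicator_apply, this]

/-- The number of `y ∈ P` with `y + h ∈ Q`. -/
def corr [Fintype G] [AddCommGroup G] (P Q : Set G) (h : G) : ℝ :=
  ∑ y, ind P y * ind Q (y + h)

section Correlation

variable [Fintype G] [AddCommGroup G]

lemma corr_neg (P Q : Set G) (h : G) : corr P Q h = corr Q P (-h) := by
  unfold corr
  rw [← Equiv.sum_comp (Equiv.addRight (-h))]
  simp [mul_comm]

lemma corr_le_card (P Q : Set G) (h : G) : corr P Q h ≤ Nat.card P := by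
  rw [← sum_ind]
  exact Finset.sum_le_sum fun y _ => mul_le_of_le_one_right (ind_nonneg _ _) (ind_le_one _ _)

lemma corr_nonneg (P Q : Set G) (h : G) : 0 ≤ corr P Q h :=
  Finset.sum_nonneg fun _ _ => mul_nonneg (ind_nonneg _ _) (ind_nonneg _ _)

lemma card_sub_corr_le {A R : Set G} (hA : A ⊆ R) (h : G) :
    (Nat.card A : ℝ) - corr A R h ≤ Nat.card R - corr R R h := by
  simp only [← sum_ind, corr, ← Finset.sum_sub_distrib]
  refine Finset.sum_le_sum fun y _ => ?_
  nlinarith [ind_mono hA y, ind_le_one R (y + h)]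

lemma dconv_ind_image (P Q : Set G) (g x : G) :
    dconv (ind P) (ind ((fun a => a + g) '' Q)) x = corr P Q (x - g) / Fintype.card G := by
  simp only [dconv, expect, corr, ind_image_add_right]
  congr 1
  refine Finset.sum_congr rfl fun y _ => ?_
  congr 2
  abel

lemma expect_dconv (u v : G → ℝ) : expect (dconv u v) = expect u * expect v := by
  simp only [dconv, expect, ← Finset.sum_div]
  rw [Finset.sum_comm]
  simp only [← Finset.mul_sum]
  have : ∀ y, ∑ x, v (x + y) = ∑ x, v x := fun y => Equiv.sum_comp (Equiv.addRight y) v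
  simp only [this, ← Finset.sum_mul]
  ring

lemma dconv_balanced_eq (A R : Set G) (g x : G) (a t : ℝ) :
    dconv (fun z => ind A z - a * (t * ind R z))
        (fun z => ind ((fun b => b + g) '' A) z - a * (t * ind ((fun b => b + g) '' R) z)) x =
      (corr A A (x - g) - a * t * corr R A (x - g) - a * t * corr A R (x - g)
        + (a * t) ^ 2 * corr R R (x - g)) / Fintype.card G := by
  simp only [dconv, expect, corr, ind_image_add_right, Finset.mul_sum,
    ← Finset.sum_sub_distrib, ← Finset.sum_add_distrib]
  congr 1
  refine Finset.sum_congr rfl fun y _ => ?_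
  rw [show x + y - g = y + (x - g) by abel]
  ring

/-- If `R` is almost invariant under translation by `±(x - g)`, then the balanced correlation of
`A ⊆ R` at `x` is close to the unbalanced one minus its expected value. -/
lemma abs_dconv_balanced_sub_le {A R : Set G} (hA : A ⊆ R) (hR : (0 : ℝ) < Nat.card R) (g x : G)
    {τ : ℝ} (h₁ : (Nat.card R : ℝ) - corr R R (x - g) ≤ τ * Nat.card R)
    (h₂ : (Nat.card R : ℝ) - corr R R (-(x - g)) ≤ τ * Nat.card R) :
    |dconv (fun z => ind A z - (Nat.card A : ℝ) / Fintype.card G * muSet R z)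
        (fun z => ind ((fun b => b + g) '' A) z -
          (Nat.card A : ℝ) / Fintype.card G * muSet ((fun b => b + g) '' R) z) x -
      (dconv (ind A) (ind ((fun b => b + g) '' A)) x -
        ((Nat.card A : ℝ) / Fintype.card G) ^ 2 * (Fintype.card G / Nat.card R))| ≤
      2 * τ * ((Nat.card A : ℝ) / Fintype.card G) := by
  have hN : (0 : ℝ) < Fintype.card G := by exact_mod_cast Fintype.card_pos
  simp only [muSet, natCard_image_add_right, dconv_balanced_eq, dconv_ind_image]
  have e1 := card_sub_corr_le hA (-(x - g))
  have e2 := card_sub_corr_le hA (x - g)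
  have e1' := corr_le_card A R (-(x - g))
  have e2' := corr_le_card A R (x - g)
  have e3' := corr_le_card R R (x - g)
  have hAR : (Nat.card A : ℝ) ≤ Nat.card R := by
    rw [← sum_ind, ← sum_ind]
    exact Finset.sum_le_sum fun y _ => ind_mono hA y
  rw [corr_neg R A]
  generalize corr A A (x - g) = j
  generalize corr A R (x - g) = c₂ at *
  generalize corr A R (-(x - g)) = c₁ at *
  generalize corr R R (x - g) = c₃ at *
  generalize corr R R (-(x - g)) = c₄ at *
  have hk : (0 : ℝ) ≤ Nat.card A := Nat.cast_nonneg _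
  generalize (Nat.card A : ℝ) = k at *
  generalize (Nat.card R : ℝ) = s at *
  generalize (Fintype.card G : ℝ) = N at *
  have key : (j - k / N * (N / s) * c₁ - k / N * (N / s) * c₂ + (k / N * (N / s)) ^ 2 * c₃) / N -
      (j / N - (k / N) ^ 2 * (N / s)) =
      k / N * (((k - c₁) + (k - c₂)) / s - (k / s) * ((s - c₃) / s)) := by
    field_simp
    ring
  have b₁ : ((k - c₁) + (k - c₂)) / s ≤ 2 * τ := by
    rw [div_le_iff₀ hR]
    linarith
  have b₁' : 0 ≤ ((k - c₁) + (k - c₂)) / s := div_nonneg (by linarith) hR.le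
  have b₂ : (s - c₃) / s ≤ τ := by rwa [div_le_iff₀ hR]
  have b₂' : 0 ≤ (s - c₃) / s := div_nonneg (by linarith) hR.le
  have b₃ : k / s ≤ 1 := (div_le_one hR).2 hAR
  have b₃' : 0 ≤ k / s := by positivity
  have b₄ : 0 ≤ k / N := by positivity
  rw [key, abs_mul, abs_of_nonneg b₄, mul_comm]
  refine mul_le_mul_of_nonneg_right (abs_le.2 ⟨?_, ?_⟩) b₄
  · nlinarith [mul_le_mul b₃ b₂ b₂' zero_le_one]
  · nlinarith [mul_nonneg b₃' b₂']

end Correlation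

section Collection

variable [Fintype G]

lemma sum_density_le {R C : Set G} [Fintype C] {A : G → Set G} (hR : (0 : ℝ) < Nat.card R)
    (hC : (0 : ℝ) < Nat.card C) {K : ℝ} (hK : 0 < K)
    (h : (Nat.card R : ℝ) * Nat.card C ≤ K * ∑ g : C, (Nat.card (A g) : ℝ)) :
    0 < ∑ g : C, ((Nat.card (A g) : ℝ) / Fintype.card G) ^ 2 ∧
      ∑ g : C, (Nat.card (A g) : ℝ) / Fintype.card G ≤
        K * (Fintype.card G / Nat.card R) *
          ∑ g : C, ((Nat.card (A g) : ℝ) / Fintype.card G) ^ 2 := by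
  have hN : (0 : ℝ) < Fintype.card G := by
    have : (Nat.card R : ℝ) ≤ Fintype.card G := by
      rw [← Nat.card_eq_fintype_card]
      exact_mod_cast Finite.card_subtype_le (· ∈ R)
    linarith
  set N : ℝ := (Fintype.card G : ℝ)
  set W := ∑ g : C, (Nat.card (A g) : ℝ) / N with hW
  set α := ∑ g : C, ((Nat.card (A g) : ℝ) / N) ^ 2
  have hcs : W ^ 2 ≤ Nat.card C * α := by
    have := sq_sum_le_card_mul_sum_sq (s := Finset.univ)
      (f := fun g : C => (Nat.card (A g) : ℝ) / N)
    rwa [Finset.card_univ, ← Nat.card_eq_fintype_card] at this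
  rw [← Finset.sum_div] at hW
  have hsum : ∑ g : C, (Nat.card (A g) : ℝ) = W * N := by rw [hW]; field_simp
  rw [hsum] at h
  clear_value W α N
  have hWpos : 0 < W := by
    have : 0 < K * (W * N) := lt_of_lt_of_le (by positivity) h
    have := pos_of_mul_pos_right this hK.le
    exact pos_of_mul_pos_left this hN.le
  have hα : 0 < α := by
    have : 0 < Nat.card C * α := (pow_pos hWpos 2).trans_le hcs
    exact pos_of_mul_pos_right this hC.le
  refine ⟨hα, le_of_mul_le_mul_left ?_ hWpos⟩
  calc W * W ≤ Nat.card C * α := by rw [← sq]; exact hcs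
    _ ≤ (K * (W * N) / Nat.card R) * α := by
        gcongr
        rw [le_div_iff₀ hR]
        linarith
    _ = _ := by ring

lemma expect_indicator_card {C : Set G} [Fintype C] (A : G → Set G) :
    expect (Set.indicator C fun x => (Nat.card (A x) : ℝ)) =
      (∑ g : C, (Nat.card (A g) : ℝ)) / Fintype.card G := by
  rw [expect, Finset.sum_indicator_eq_sum_filter]
  congr 1
  rw [Finset.sum_subtype (p := (· ∈ C))]
  simp

lemma muFun_indicator_card_nonneg {C : Set G} (A : G → Set G) (x : G) :
    0 ≤ muFun (Set.indicator C fun x => (Nat.card (A x) : ℝ)) x := by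
  have h : ∀ x, 0 ≤ Set.indicator C (fun x => (Nat.card (A x) : ℝ)) x :=
    Set.indicator_nonneg fun _ _ => Nat.cast_nonneg _
  exact div_nonneg (h x) (div_nonneg (Finset.sum_nonneg fun x _ => h x) (Nat.cast_nonneg _))

lemma muFun_indicator_card_le {R C : Set G} [Fintype C] {A : G → Set G}
    (hA : ∀ g ∈ C, A g ⊆ R) (hR : (0 : ℝ) < Nat.card R) (hC : (0 : ℝ) < Nat.card C)
    {K : ℝ} (hK : 0 < K)
    (h : (Nat.card R : ℝ) * Nat.card C ≤ K * ∑ g : C, (Nat.card (A g) : ℝ)) (x : G) :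
    muFun (Set.indicator C fun x => (Nat.card (A x) : ℝ)) x ≤ K * muSet C x := by
  rw [muFun, expect_indicator_card, muSet, ind]
  by_cases hx : x ∈ C
  · rw [Set.indicator_of_mem hx, Set.indicator_of_mem hx]
    have hAR : (Nat.card (A x) : ℝ) ≤ Nat.card R := by
      exact_mod_cast Nat.card_mono (Set.toFinite R) (hA x hx)
    have hS : 0 < ∑ g : C, (Nat.card (A g) : ℝ) :=
      pos_of_mul_pos_right (lt_of_lt_of_le (by positivity) h) hK.le
    rw [div_div_eq_mul_div, mul_one, mul_div_assoc', div_le_div_iff₀ hS hC]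
    calc (Nat.card (A x) : ℝ) * Fintype.card G * Nat.card C
        ≤ Nat.card R * Fintype.card G * Nat.card C := by gcongr
      _ = Fintype.card G * (Nat.card R * Nat.card C) := by ring
      _ ≤ Fintype.card G * (K * ∑ g : C, (Nat.card (A g) : ℝ)) := by gcongr
      _ = _ := by ring
  · simp [Set.indicator_of_notMem hx]

lemma expect_mul_pow_le {w F : G → ℝ} (hw : ∀ x, 0 ≤ w x) (hw1 : expect w = 1)
    (hF : ∀ x, 0 ≤ F x) (p : ℕ) :
    expect (fun x => w x * F x) ^ p ≤ expect (fun x => w x * F x ^ p) := by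
  have := Real.pow_arith_mean_le_arith_mean_pow Finset.univ
    (fun x => w x / Fintype.card G) F (fun x _ => div_nonneg (hw x) (Nat.cast_nonneg _))
    (by rw [← Finset.sum_div]; exact hw1) (fun x _ => hF x) p
  simp only [div_mul_eq_mul_div, ← Finset.sum_div] at this
  exact this

lemma expect_lt_pow_of_wnorm_lt {p : ℕ} (hp : p ≠ 0) {w F : G → ℝ} (hw : ∀ x, 0 ≤ w x) {b : ℝ}
    (h : wnorm p w F < b) : expect (fun x => w x * |F x| ^ p) < b ^ p := by
  have h0 : 0 ≤ expect (fun x => w x * |F x| ^ p) :=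
    div_nonneg (Finset.sum_nonneg fun x _ => mul_nonneg (hw x) (by positivity))
      (Nat.cast_nonneg _)
  rw [← Real.rpow_inv_natCast_pow h0 hp]
  exact pow_lt_pow_left₀ h (Real.rpow_nonneg h0 _) hp

/-- If `w` is a probability density with `w ≤ K ν` and `K ≤ 2 ^ n`, then a lower bound for the
`w`-mean of `|F|` passes, up to a constant, to the `L^{2n}(ν)` norm of `F`. -/
lemma le_wnorm_of_lt_expect {w ν F : G → ℝ} (hw : ∀ x, 0 ≤ w x) (hw1 : expect w = 1)
    (hν : ∀ x, 0 ≤ ν x) {K : ℝ} (hK : 0 ≤ K) (hwν : ∀ x, w x ≤ K * ν x) {n : ℕ} (hn : n ≠ 0)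
    (hKn : K ≤ 2 ^ n) {b : ℝ} (hb : 0 ≤ b) (h : 3 / 2 * b < expect (fun x => w x * |F x|)) :
    b ≤ wnorm (2 * n) ν F := by
  by_contra! hlt
  have hup := expect_lt_pow_of_wnorm_lt (by omega) hν hlt
  have hchain : (3 / 2 * b) ^ (2 * n) < 2 ^ n * b ^ (2 * n) :=
    calc (3 / 2 * b) ^ (2 * n) < expect (fun x => w x * |F x|) ^ (2 * n) :=
          pow_lt_pow_left₀ h (by positivity) (by omega)
      _ ≤ expect (fun x => w x * |F x| ^ (2 * n)) :=
          expect_mul_pow_le hw hw1 (fun x => abs_nonneg _) _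
      _ ≤ expect (fun x => ν x * |F x| ^ (2 * n) * K) := by
          refine expect_mono fun x => ?_
          rw [mul_right_comm, mul_comm _ K]
          exact mul_le_mul_of_nonneg_right (hwν x) (by positivity)
      _ = K * expect (fun x => ν x * |F x| ^ (2 * n)) := by
          rw [expect_mul_const, mul_comm]
      _ ≤ K * b ^ (2 * n) := by gcongr
      _ ≤ _ := by gcongr
  rw [pow_mul, pow_mul, ← mul_pow] at hchain
  refine absurd hchain (not_lt.2 (pow_le_pow_left₀ (by positivity) ?_ n))
  nlinarith [sq_nonneg b]

end Collection

section Dichotomy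

variable [Fintype G] [AddCommGroup G]

lemma expect_sum_dconv_ind {C : Set G} [Fintype C] (A : G → Set G) :
    expect (fun y => ∑ g : C, dconv (ind (A g)) (ind ((fun a => a + (g : G)) '' A g)) y) =
      ∑ g : C, ((Nat.card (A g) : ℝ) / Fintype.card G) ^ 2 := by
  have : ∀ g : C, expect (dconv (ind (A g)) (ind ((fun a => a + (g : G)) '' A g))) =
      ((Nat.card (A g) : ℝ) / Fintype.card G) ^ 2 := fun g => by
    rw [expect_dconv, expect_ind, expect_ind, natCard_image_add_right, sq]
  simp only [← this, expect]
  rw [Finset.sum_comm, Finset.sum_div]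

lemma inprod_muFun_le {R C : Set G} [Fintype C] {A : G → Set G}
    (hR : (0 : ℝ) < Nat.card R) (hC : (0 : ℝ) < Nat.card C)
    {K : ℝ} (hK : 0 < K)
    (h : (Nat.card R : ℝ) * Nat.card C ≤ K * ∑ g : C, (Nat.card (A g) : ℝ)) :
    0 ≤ inprod (muFun fun y => ∑ g : C, dconv (ind (A g)) (ind ((fun a => a + (g : G)) '' A g)) y)
      (muFun (Set.indicator C fun x => (Nat.card (A x) : ℝ))) ∧
    inprod (muFun fun y => ∑ g : C, dconv (ind (A g)) (ind ((fun a => a + (g : G)) '' A g)) y)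
      (muFun (Set.indicator C fun x => (Nat.card (A x) : ℝ))) ≤
      K * (Fintype.card G / Nat.card R) := by
  obtain ⟨hα, hW⟩ := sum_density_le hR hC hK h
  have hf : ∀ x, 0 ≤ muFun (fun y => ∑ g : C,
      dconv (ind (A g)) (ind ((fun a => a + (g : G)) '' A g)) y) x ∧
      muFun (fun y => ∑ g : C,
      dconv (ind (A g)) (ind ((fun a => a + (g : G)) '' A g)) y) x ≤
      K * (Fintype.card G / Nat.card R) := by
    intro x
    rw [muFun, expect_sum_dconv_ind]
    simp only [dconv_ind_image]
    constructor
    · exact div_nonneg (Finset.sum_nonneg fun g _ =>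
        div_nonneg (corr_nonneg _ _ _) (Nat.cast_nonneg _)) hα.le
    · rw [div_le_iff₀ hα]
      refine le_trans (Finset.sum_le_sum fun g _ => ?_) hW
      gcongr
      exact corr_le_card _ _ _
  have hD := muFun_indicator_card_nonneg (C := C) A
  constructor
  · exact div_nonneg (Finset.sum_nonneg fun x _ => mul_nonneg (hf x).1 (hD x))
      (Nat.cast_nonneg _)
  · have hD1 : expect (muFun (Set.indicator C fun x => (Nat.card (A x) : ℝ))) = 1 := by
      apply expect_muFun
      rw [expect_indicator_card, Finset.sum_div]
      intro h0
      have h1 := (Finset.sum_eq_zero_iff_of_nonneg (fun g _ => by positivity)).1 h0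
      rw [Finset.sum_eq_zero fun g hg => by rw [h1 g hg]; norm_num] at hα
      exact hα.false
    calc _ ≤ expect (fun x => muFun (Set.indicator C fun x => (Nat.card (A x) : ℝ)) x *
          (K * (Fintype.card G / Nat.card R))) := by
          refine expect_mono fun x => ?_
          rw [mul_comm]
          exact mul_le_mul_of_nonneg_left (hf x).2 (hD x)
      _ = _ := by rw [expect_mul_const, hD1, one_mul]

/-- On `C`, the normalised balanced correlation is close to `μ_f - μ(R)⁻¹`. -/
lemma abs_balanced_sub_muFun_le {R C : Set G} [Fintype C] {A : G → Set G}
    (hA : ∀ g ∈ C, A g ⊆ R) (hR : (0 : ℝ) < Nat.card R) (hC : (0 : ℝ) < Nat.card C)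
    {K : ℝ} (hK : 0 < K)
    (h : (Nat.card R : ℝ) * Nat.card C ≤ K * ∑ g : C, (Nat.card (A g) : ℝ))
    {τ : ℝ} (hτ : 0 ≤ τ)
    (hstab : ∀ x ∈ C, ∀ g ∈ C, (Nat.card R : ℝ) - corr R R (x - g) ≤ τ * Nat.card R)
    {x : G} (hx : x ∈ C) :
    |(∑ g : C, ((Nat.card (A g) : ℝ) / Fintype.card G) ^ 2)⁻¹ * ∑ g : C,
        dconv (fun z => ind (A g) z - (Nat.card (A g) : ℝ) / Fintype.card G * muSet R z)
          (fun z => ind ((fun a => a + (g : G)) '' A g) z -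
            (Nat.card (A g) : ℝ) / Fintype.card G * muSet ((fun a => a + (g : G)) '' R) z) x -
      (muFun (fun y => ∑ g : C, dconv (ind (A g)) (ind ((fun a => a + (g : G)) '' A g)) y) x -
        Fintype.card G / Nat.card R)| ≤ 2 * τ * K * (Fintype.card G / Nat.card R) := by
  obtain ⟨hα, hW⟩ := sum_density_le hR hC hK h
  have hpt := fun g : C => abs_dconv_balanced_sub_le (hA g g.2) hR g x
    (hstab x hx g g.2) (by rw [neg_sub]; exact hstab g g.2 x hx)
  rw [muFun, expect_sum_dconv_ind]
  have hsum := (Finset.abs_sum_le_sum_abs _ _).trans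
    (Finset.sum_le_sum fun (g : C) (_ : g ∈ Finset.univ) => hpt g)
  rw [Finset.sum_sub_distrib, Finset.sum_sub_distrib, ← Finset.sum_mul, ← Finset.mul_sum] at hsum
  set α := ∑ g : C, ((Nat.card (A g) : ℝ) / Fintype.card G) ^ 2
  set X := ∑ g : C,
    dconv (fun z => ind (A g) z - (Nat.card (A g) : ℝ) / Fintype.card G * muSet R z)
      (fun z => ind ((fun a => a + (g : G)) '' A g) z -
        (Nat.card (A g) : ℝ) / Fintype.card G * muSet ((fun a => a + (g : G)) '' R) z) x
  set Y := ∑ g : C, dconv (ind (A g)) (ind ((fun a => a + (g : G)) '' A g)) x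
  have : α⁻¹ * X - (Y / α - Fintype.card G / Nat.card R) =
      (X - (Y - α * (Fintype.card G / Nat.card R))) / α := by
    field_simp
  rw [this, abs_div, abs_of_pos hα, div_le_iff₀ hα]
  nlinarith [mul_le_mul_of_nonneg_left hW (by positivity : 0 ≤ 2 * τ)]

/-- Either `f` and `D` correlate as expected, or the balanced correlation has a large `L^p` norm
on `C`. -/
lemma abs_inprod_sub_le_or_le_wnorm {R C : Set G} [Fintype C] {A : G → Set G}
    (hA : ∀ g ∈ C, A g ⊆ R) (hR : (0 : ℝ) < Nat.card R) (hC : (0 : ℝ) < Nat.card C)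
    {K : ℝ} (hK : 0 < K)
    (h : (Nat.card R : ℝ) * Nat.card C ≤ K * ∑ g : C, (Nat.card (A g) : ℝ))
    {τ ε : ℝ} (hτ : 0 ≤ τ) (hε : 0 < ε) (hτε : 2 * τ * K ≤ ε / 4)
    (hstab : ∀ x ∈ C, ∀ g ∈ C, (Nat.card R : ℝ) - corr R R (x - g) ≤ τ * Nat.card R)
    {n : ℕ} (hn : n ≠ 0) (hKn : K ≤ 2 ^ n) :
    |inprod (muFun fun y => ∑ g : C, dconv (ind (A g)) (ind ((fun a => a + (g : G)) '' A g)) y)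
        (muFun (Set.indicator C fun x => (Nat.card (A x) : ℝ))) -
        Fintype.card G / Nat.card R| ≤ ε * (Fintype.card G / Nat.card R) ∨
      ε / 2 * (Fintype.card G / Nat.card R) ≤ wnorm (2 * n) (muSet C) (fun y =>
        (∑ g : C, ((Nat.card (A g) : ℝ) / Fintype.card G) ^ 2)⁻¹ * ∑ g : C,
        dconv (fun z => ind (A g) z - (Nat.card (A g) : ℝ) / Fintype.card G * muSet R z)
          (fun z => ind ((fun a => a + (g : G)) '' A g) z -
            (Nat.card (A g) : ℝ) / Fintype.card G * muSet ((fun a => a + (g : G)) '' R) z) y) := by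
  by_contra! hcon
  obtain ⟨hbig, hsmall⟩ := hcon
  have hN : (0 : ℝ) < Fintype.card G := by exact_mod_cast Fintype.card_pos
  have hD := muFun_indicator_card_nonneg (C := C) A
  have hDle := muFun_indicator_card_le hA hR hC hK h
  have hD1 : expect (muFun (Set.indicator C fun x => (Nat.card (A x) : ℝ))) = 1 := by
    apply expect_muFun
    rw [expect_indicator_card]
    have : 0 < ∑ g : C, (Nat.card (A g) : ℝ) :=
      pos_of_mul_pos_right (lt_of_lt_of_le (by positivity) h) hK.le
    positivity
  have hclose := fun x hx => abs_balanced_sub_muFun_le hA hR hC hK h hτ hstab (x := x) hx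
  have hDC : ∀ x ∉ C, muFun (Set.indicator C fun x => (Nat.card (A x) : ℝ)) x = 0 := by
    intro x hx
    rw [muFun, Set.indicator_of_notMem hx, zero_div]
  set f := muFun fun y => ∑ g : C, dconv (ind (A g)) (ind ((fun a => a + (g : G)) '' A g)) y
  set D := muFun (Set.indicator C fun x => (Nat.card (A x) : ℝ))
  set F := fun y => (∑ g : C, ((Nat.card (A g) : ℝ) / Fintype.card G) ^ 2)⁻¹ * ∑ g : C,
        dconv (fun z => ind (A g) z - (Nat.card (A g) : ℝ) / Fintype.card G * muSet R z)
          (fun z => ind ((fun a => a + (g : G)) '' A g) z -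
            (Nat.card (A g) : ℝ) / Fintype.card G * muSet ((fun a => a + (g : G)) '' R) z) y
  have hM : (0 : ℝ) < Fintype.card G / Nat.card R := by positivity
  set M : ℝ := Fintype.card G / Nat.card R
  have hlow : 3 / 4 * ε * M < expect (fun x => D x * |F x|) := by
    have h1 : inprod f D - M = expect (fun x => f x * D x - D x * M) := by
      rw [expect_sub, expect_mul_const, hD1, one_mul, inprod]
    have h2 : expect (fun x => |f x * D x - D x * M|) ≤
        expect (fun x => D x * |F x| - D x * -(ε / 4 * M)) := by
      refine expect_mono fun x => ?_
      by_cases hx : x ∈ C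
      · rw [show f x * D x - D x * M = D x * (f x - M) by ring, abs_mul, abs_of_nonneg (hD x),
          ← mul_sub]
        refine mul_le_mul_of_nonneg_left ?_ (hD x)
        have h3 : |F x - (f x - M)| ≤ ε / 4 * M :=
          (hclose x hx).trans (mul_le_mul_of_nonneg_right hτε hM.le)
        have := abs_sub_abs_le_abs_sub (f x - M) (F x)
        rw [abs_sub_comm (f x - M)] at this
        linarith
      · simp [hDC x hx]
    rw [expect_sub, expect_mul_const, hD1] at h2
    have := abs_expect_le (fun x => f x * D x - D x * M)
    rw [← h1] at this
    linarith
  have hC0 : ∀ x, 0 ≤ muSet C x := fun x =>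
    mul_nonneg (by positivity) (ind_nonneg C x)
  exact hsmall.not_ge (le_wnorm_of_lt_expect hD hD1 hC0 hK.le hDle hn hKn (by positivity)
    (by linarith))

end Dichotomy

namespace BohrSet

variable [AddCommGroup G]

lemma toSet_eq_empty_of_width_neg {B : BohrSet G} (hB : B.width < 0) (hr : B.rank ≠ 0) :
    B.toSet = ∅ := by
  obtain ⟨γ, hγ⟩ := Finset.card_ne_zero.1 hr
  exact Set.eq_empty_of_forall_notMem fun x hx =>
    absurd (hx γ hγ) (not_le.2 (hB.trans_le (norm_nonneg _)))

lemma zero_mem_toSet {B : BohrSet G} (hB : 0 ≤ B.width) : (0 : G) ∈ B.toSet := by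
  intro γ _
  simpa using hB

lemma norm_one_sub_sub_le [Fintype G] (γ : AddChar G ℂ) (x y : G) :
    ‖(1 : ℂ) - γ (x - y)‖ ≤ ‖(1 : ℂ) - γ x‖ + ‖(1 : ℂ) - γ y‖ := by
  have hy : ‖γ y‖ = 1 := γ.norm_apply y
  have hm : γ (x - y) * γ y = γ x := by rw [← AddChar.map_add_eq_mul, sub_add_cancel]
  calc ‖(1 : ℂ) - γ (x - y)‖ = ‖((1 : ℂ) - γ (x - y)) * γ y‖ := by rw [norm_mul, hy, mul_one]
    _ = ‖((1 : ℂ) - γ x) - ((1 : ℂ) - γ y)‖ := by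
        congr 1
        linear_combination -hm
    _ ≤ _ := norm_sub_le _ _

lemma norm_one_sub_add_le [Fintype G] (γ : AddChar G ℂ) (x y : G) :
    ‖(1 : ℂ) - γ (x + y)‖ ≤ ‖(1 : ℂ) - γ x‖ + ‖(1 : ℂ) - γ y‖ := by
  have h := norm_one_sub_sub_le γ 0 y
  have h' := norm_one_sub_sub_le γ x (-y)
  simp only [AddChar.map_zero_eq_one, sub_self, norm_zero, zero_add, zero_sub] at h
  rw [sub_neg_eq_add] at h'
  linarith

/-- A regular Bohr set is almost invariant under translation by differences of elements of a small
dilate. -/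
lemma IsRegular.card_sub_corr_le [Fintype G] {B : BohrSet G} (hB : B.IsRegular)
    (hw : 0 ≤ B.width) {σ : ℝ} (hσ : 0 ≤ σ) (hσr : 2 * σ ≤ 1 / (100 * B.rank)) {x g : G}
    (hx : x ∈ (B.dilate σ).toSet) (hg : g ∈ (B.dilate σ).toSet) :
    (Nat.card B.toSet : ℝ) - corr B.toSet B.toSet (x - g) ≤
      200 * σ * B.rank * Nat.card B.toSet := by
  have h := (hB (2 * σ) (by linarith) hσr).2
  have hsub : (Nat.card (B.dilate (1 - 2 * σ)).toSet : ℝ) ≤ corr B.toSet B.toSet (x - g) := by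
    rw [← sum_ind, corr]
    refine Finset.sum_le_sum fun y _ => ?_
    by_cases hy : y ∈ (B.dilate (1 - 2 * σ)).toSet
    · have hy1 : y ∈ B.toSet := fun γ hγ =>
        (hy γ hγ).trans (mul_le_of_le_one_left hw (by linarith))
      have hy2 : y + (x - g) ∈ B.toSet := by
        intro γ hγ
        have h1 : ‖(1 : ℂ) - γ y‖ ≤ (1 - 2 * σ) * B.width := hy γ hγ
        have h2 : ‖(1 : ℂ) - γ x‖ ≤ σ * B.width := hx γ hγ
        have h3 : ‖(1 : ℂ) - γ g‖ ≤ σ * B.width := hg γ hγ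
        linarith [norm_one_sub_add_le γ y (x - g), norm_one_sub_sub_le γ x g]
      simp [ind, hy, hy1, hy2]
    · rw [ind, Set.indicator_of_notMem hy]
      exact mul_nonneg (ind_nonneg _ _) (ind_nonneg _ _)
  linarith

end BohrSet

theorem statement18 :
    ∃ c C : ℝ, 0 < c ∧ 0 < C ∧
      ∀ (G : Type) [AddCommGroup G] [Fintype G],
      ∀ ε : ℝ, 0 < ε → ∀ d : ℝ, 0 ≤ d →
      ∀ R : BohrSet G, R.IsRegular →
      ∀ σ : ℝ, 0 < σ → σ ≤ c * ε / ((R.rank : ℝ) * (2 : ℝ) ^ d) →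
      (R.dilate σ).IsRegular →
      ∀ A : G → Set G, (∀ g ∈ (R.dilate σ).toSet, A g ⊆ R.toSet) →
        (2 : ℝ) ^ (-d) * (Nat.card R.toSet : ℝ) * (Nat.card (R.dilate σ).toSet : ℝ) ≤
          ∑ g : ↥(R.dilate σ).toSet, (Nat.card (A ↑g) : ℝ) →
      ∀ α : ℝ, α = ∑ g : ↥(R.dilate σ).toSet,
          ((Nat.card (A ↑g) : ℝ) / (Fintype.card G : ℝ)) ^ 2 →
      ∀ f D : G → ℝ,
        f = (fun y => ∑ g : ↥(R.dilate σ).toSet,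
          dconv (ind (A ↑g)) (ind ((fun a => a + (↑g : G)) '' A ↑g)) y) →
        D = Set.indicator (R.dilate σ).toSet (fun x => (Nat.card (A x) : ℝ)) →
        |inprod (muFun f) (muFun D) - R.measure⁻¹| ≤ ε * R.measure⁻¹ ∨
        ∃ p : ℕ, Even p ∧ 2 ≤ p ∧ (p : ℝ) ≤ C * (d + 1) ∧
          ε / 2 * R.measure⁻¹ ≤
            wnorm p ((R.dilate σ).mu)
              (fun y => α⁻¹ * ∑ g : ↥(R.dilate σ).toSet,
                dconv
                  (fun z => ind (A ↑g) z -
                    (Nat.card (A ↑g) : ℝ) / (Fintype.card G : ℝ) * muSet R.toSet z)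
                  (fun z => ind ((fun a => a + (↑g : G)) '' A ↑g) z -
                    (Nat.card (A ↑g) : ℝ) / (Fintype.card G : ℝ) *
                      muSet ((fun a => a + (↑g : G)) '' R.toSet) z) y) := by
  refine ⟨1 / 1600, 4, by norm_num, by norm_num, ?_⟩
  intro G _ _ ε hε d hd R hreg σ hσ hσle _ A hA hden α hα f D hf hD
  have hN : (0 : ℝ) < Fintype.card G := by exact_mod_cast Fintype.card_pos
  have hr0 : R.rank ≠ 0 := by
    intro h0
    rw [h0] at hσle
    simp only [Nat.cast_zero, zero_mul, div_zero] at hσle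
    linarith
  have hr : (0 : ℝ) < R.rank := by exact_mod_cast Nat.pos_of_ne_zero hr0
  have hmeas : R.measure⁻¹ = Fintype.card G / Nat.card R.toSet := by
    rw [BohrSet.measure, inv_div]
  rw [hmeas]
  rcases lt_or_ge R.width 0 with hw | hw
  · left
    have hempty : (R.dilate σ).toSet = ∅ :=
      BohrSet.toSet_eq_empty_of_width_neg (mul_neg_of_pos_of_neg hσ hw) hr0
    have hDz : D = 0 := by
      rw [hD, hempty, Set.indicator_empty]
      rfl
    simp [hDz, BohrSet.toSet_eq_empty_of_width_neg hw hr0, inprod, muFun, expect]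
  have hR : (0 : ℝ) < Nat.card R.toSet := by
    have : Nonempty R.toSet := ⟨⟨0, BohrSet.zero_mem_toSet hw⟩⟩
    exact_mod_cast Nat.card_pos
  have hC : (0 : ℝ) < Nat.card (R.dilate σ).toSet := by
    have : Nonempty (R.dilate σ).toSet := ⟨⟨0, BohrSet.zero_mem_toSet (mul_nonneg hσ.le hw)⟩⟩
    exact_mod_cast Nat.card_pos
  have hK : (0 : ℝ) < 2 ^ d := by positivity
  have hK1 : (1 : ℝ) ≤ 2 ^ d := Real.one_le_rpow (by norm_num) hd
  have hden' : (Nat.card R.toSet : ℝ) * Nat.card (R.dilate σ).toSet ≤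
      2 ^ d * ∑ g : ↥(R.dilate σ).toSet, (Nat.card (A ↑g) : ℝ) := by
    rw [Real.rpow_neg (by norm_num), mul_assoc, inv_mul_le_iff₀ hK] at hden
    exact hden
  have hM : (0 : ℝ) < Fintype.card G / Nat.card R.toSet := by positivity
  subst hα hf hD
  rcases le_or_gt ((2 : ℝ) ^ d) ε with hbig | hsmall
  · left
    obtain ⟨h0, h1⟩ := inprod_muFun_le hR hC hK hden'
    have h2 := mul_le_mul_of_nonneg_right hbig hM.le
    have h3 := mul_le_mul_of_nonneg_right hK1 hM.le
    rw [abs_le]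
    constructor <;> linarith
  · have hσ1 : σ * R.rank * 2 ^ d ≤ 1 / 1600 * ε := by
      rw [le_div_iff₀ (by positivity)] at hσle
      linarith
    have hσ2 : σ * R.rank ≤ 1 / 1600 := by
      refine le_of_mul_le_mul_right (hσ1.trans ?_) hK
      linarith
    have hσr : 2 * σ ≤ 1 / (100 * R.rank) := by
      rw [le_div_iff₀ (by positivity)]
      linarith
    have hn : ⌈d + 1⌉₊ ≠ 0 := (Nat.ceil_pos.2 (by linarith)).ne'
    have hKn : (2 : ℝ) ^ d ≤ 2 ^ ⌈d + 1⌉₊ := by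
      rw [← Real.rpow_natCast]
      exact Real.rpow_le_rpow_of_exponent_le (by norm_num) (by linarith [Nat.le_ceil (d + 1)])
    refine (abs_inprod_sub_le_or_le_wnorm hA hR hC hK hden' (τ := 200 * σ * R.rank)
      (by positivity) hε (by linarith)
      (fun x hx g hg => hreg.card_sub_corr_le hw hσ.le hσr hx hg) hn hKn).imp_right
      fun h => ⟨2 * ⌈d + 1⌉₊, even_two_mul _, by omega, ?_, h⟩
    have := Nat.ceil_lt_add_one (show (0 : ℝ) ≤ d + 1 by linarith)
    push_cast
    linarith


end SkewPaper
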